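/- arXiv:2410.13108 — 9 statements merged into one kernel-verified Lean document; each statement's English description precedes it below -/
import Mathlib

section
/- Let γ ∈ (0,1), p ∈ [0,1] and c ∈ [0,1]. Define the non-homogeneous geometric weights w(1) := p and, for every integer k ≥ 2, w(k) := (1−p)·(1−c)·p·(1−(1−c)·p)^{k−2}. Then the series Σ_{k=1}^∞ γ^k · w(k) converges and equals p·γ + ((1−p)·(1−c)·p·γ^2)/(1 − γ·(1 − (1−c)·p)); equivalently, it equals γ·f̃_{γ,c}(p). (This is the computation of E[γ^X] for the non-homogeneous geometric return time X ~ Geo(p,c), which is the core of Theorem 2.2: the variable discount rate induced by user disengagement with friction.) -/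
noncomputable section

/-- The modified demand value `f̃_{γ,c}(p)`. -/
def ftildeVal (γ c p : ℝ) : ℝ :=
  p + ((1 - p) * (1 - c) * p * γ) / (1 - γ * (1 - (1 - c) * p))

/-- The non-homogeneous geometric series `Σ_{k=1}^∞ γ^k · w(k)` converges to
`p·γ + ((1−p)·(1−c)·p·γ²)/(1 − γ·(1 − (1−c)·p))`, which equals `γ·f̃_{γ,c}(p)`. -/
theorem stmt0 (γ p c : ℝ) (hγ : γ ∈ Set.Ioo (0:ℝ) 1)
    (hp : p ∈ Set.Icc (0:ℝ) 1) (hc : c ∈ Set.Icc (0:ℝ) 1)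
    (w : ℕ → ℝ) (hw1 : w 1 = p)
    (hwk : ∀ k : ℕ, 2 ≤ k → w k = (1 - p) * (1 - c) * p * (1 - (1 - c) * p) ^ (k - 2)) :
    HasSum (fun k : ℕ => γ ^ (k + 1) * w (k + 1))
      (p * γ + ((1 - p) * (1 - c) * p * γ ^ 2) / (1 - γ * (1 - (1 - c) * p))) ∧
    p * γ + ((1 - p) * (1 - c) * p * γ ^ 2) / (1 - γ * (1 - (1 - c) * p))
      = γ * ftildeVal γ c p := by
  obtain ⟨hγ0, hγ1⟩ := hγ
  obtain ⟨hp0, hp1⟩ := hp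
  obtain ⟨hc0, hc1⟩ := hc
  constructor
  · have ha0 : 0 ≤ (1 - c) * p := mul_nonneg (by linarith) hp0
    have ha1 : (1 - c) * p ≤ 1 := mul_le_one₀ (by linarith) hp0 hp1
    have hr0 : 0 ≤ γ * (1 - (1 - c) * p) := mul_nonneg hγ0.le (by linarith)
    have hr1 : γ * (1 - (1 - c) * p) < 1 := by nlinarith
    have h := (hasSum_geometric_of_lt_one hr0 hr1).mul_left ((1 - p) * (1 - c) * p * γ ^ 2)
    have h2 : HasSum (fun k : ℕ => γ ^ (k + 1 + 1) * w (k + 1 + 1))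
        ((1 - p) * (1 - c) * p * γ ^ 2 / (1 - γ * (1 - (1 - c) * p))) := by
      rw [div_eq_mul_inv]
      refine (congrArg (fun f => HasSum f _) (funext fun k => ?_)).mpr h
      rw [hwk (k + 1 + 1) (by omega), show k + 1 + 1 - 2 = k by omega, mul_pow]
      ring
    have h3 := HasSum.zero_add (f := fun k : ℕ => γ ^ (k + 1) * w (k + 1)) h2
    convert h3 using 2
    simp [hw1, mul_comm]
  · unfold ftildeVal
    ring
end
end

section
/- Suppose the demand function f has complexity k for some finite k ≥ 1, and let g be an optimal simple policy. Fix any initial state y ∈ ℝ, let (x_t)_{t≥1} be the trajectory of g from x₁ = y, and let T ≥ 2 be such that f is continuous at each of x₂, …, x_T. Then: (1) if g(x_T) > −K, then g(x_t) = K for every 1 ≤ t ≤ T−1; and (2) if g(x₁) < K, then g(x_t) = −K for every 2 ≤ t ≤ T. -/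
noncomputable section

open Filter Topology

/-- The modified demand function `f̃` built from the demand function `f`,
discount `γ` and friction `c`. -/
def ftilde (γ c : ℝ) (f : ℝ → ℝ) (x : ℝ) : ℝ :=
  f x + ((1 - f x) * (1 - c) * f x * γ) / (1 - γ * (1 - (1 - c) * f x))

/-- States generated by an action sequence `a` from initial state `x0`:
`stTraj CE a x0 (t-1)` is the paper's `x_t`, so `stTraj CE a x0 0 = x0` is `x₁`. -/
def stTraj (CE : ℝ) (a : ℕ → ℝ) (x0 : ℝ) : ℕ → ℝ
  | 0 => x0
  | n + 1 => stTraj CE a x0 n + CE - a n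

/-- (Discounted) payoff `J_{x0}(a)` of the action sequence `a` from initial state `x0`:
`Σ_{t=1}^∞ (C_R + a_t)·Π_{τ=2}^{t} (γ·f̃(x_τ))`. -/
def payoff (γ c CR CE : ℝ) (f : ℝ → ℝ) (x0 : ℝ) (a : ℕ → ℝ) : ℝ :=
  ∑' t : ℕ, (CR + a t) *
    ∏ τ ∈ Finset.range t, (γ * ftilde γ c f (stTraj CE a x0 (τ + 1)))

/-- Trajectory induced by a simple policy `g` from initial state `x0`:
`polTraj CE g x0 (t-1)` is the paper's `x_t`. -/
def polTraj (CE : ℝ) (g : ℝ → ℝ) (x0 : ℝ) : ℕ → ℝ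
  | 0 => x0
  | n + 1 => polTraj CE g x0 n + CE - g (polTraj CE g x0 n)

/-- Payoff `J_{x0}(g)` of the simple policy `g` from initial state `x0`. -/
def polPayoff (γ c CR CE : ℝ) (f : ℝ → ℝ) (g : ℝ → ℝ) (x0 : ℝ) : ℝ :=
  payoff γ c CR CE f x0 (fun n => g (polTraj CE g x0 n))

/-- An action sequence takes values in `[-K, K]`. -/
def IsActionSeq (K : ℝ) (a : ℕ → ℝ) : Prop := ∀ n, a n ∈ Set.Icc (-K) K

/-- A simple policy takes values in `[-K, K]`. -/
def IsSimplePolicy (K : ℝ) (g : ℝ → ℝ) : Prop := ∀ x, g x ∈ Set.Icc (-K) K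

/-- A simple policy `g` is optimal if from every initial state it weakly dominates
every action sequence. -/
def IsOptimal (γ c CR CE K : ℝ) (f : ℝ → ℝ) (g : ℝ → ℝ) : Prop :=
  IsSimplePolicy K g ∧
  ∀ x0 : ℝ, ∀ a : ℕ → ℝ, IsActionSeq K a →
    payoff γ c CR CE f x0 a ≤ polPayoff γ c CR CE f g x0

/-- `f` has complexity `k`: it is piecewise constant with breakpoints `b₁ < … < b_k`,
constant on `(−∞,b₁)` and on each `[bᵢ, b_{i+1})` and `[b_k, ∞)`. -/
def HasComplexity (f : ℝ → ℝ) (k : ℕ) : Prop :=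
  ∃ b : Fin k → ℝ, StrictMono b ∧
    (∀ x y : ℝ, (∀ j : Fin k, x < b j) → (∀ j : Fin k, y < b j) → f x = f y) ∧
    (∀ i : Fin k, ∀ x y : ℝ, b i ≤ x → b i ≤ y →
      (∀ j : Fin k, i < j → x < b j) → (∀ j : Fin k, i < j → y < b j) → f x = f y)

/-- The value function `V(x)`: supremum of payoffs of action sequences from `x`. -/
def V (γ c CR CE K : ℝ) (f : ℝ → ℝ) (x : ℝ) : ℝ :=
  sSup {v : ℝ | ∃ a : ℕ → ℝ, IsActionSeq K a ∧ payoff γ c CR CE f x a = v}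

/-- The Q-function `Q(i,x) = C_R + i + γ·f̃(x + C_E − i)·V(x + C_E − i)`. -/
def Q (γ c CR CE K : ℝ) (f : ℝ → ℝ) (i x : ℝ) : ℝ :=
  CR + i + γ * ftilde γ c f (x + CE - i) * V γ c CR CE K f (x + CE - i)

theorem ftilde_mem (γ c : ℝ) (f : ℝ → ℝ) (hγ : γ ∈ Set.Ioo (0:ℝ) 1) (hc : c ∈ Set.Icc (0:ℝ) 1)
    (hf01 : ∀ x, f x ∈ Set.Icc (0:ℝ) 1) (x : ℝ) : ftilde γ c f x ∈ Set.Icc (0:ℝ) 1 := by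
  obtain ⟨h0, h1⟩ := hf01 x
  obtain ⟨g0, g1⟩ := hγ
  obtain ⟨c0, c1⟩ := hc
  unfold ftilde
  generalize f x = u at *
  have hp0 : 0 ≤ (1 - c) * u := mul_nonneg (by linarith) h0
  have hpg : 0 ≤ γ * ((1 - c) * u) := mul_nonneg g0.le hp0
  have hD : 0 < 1 - γ * (1 - (1 - c) * u) := by nlinarith
  have hN : 0 ≤ (1 - u) * (1 - c) * u * γ := by
    have : 0 ≤ (1 - u) * (γ * ((1 - c) * u)) := mul_nonneg (by linarith) hpg
    nlinarith
  have hle : ((1 - u) * (1 - c) * u * γ) / (1 - γ * (1 - (1 - c) * u)) ≤ 1 - u := by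
    rw [div_le_iff₀ hD]
    have : 0 ≤ (1 - u) * (1 - γ) := mul_nonneg (by linarith) (by linarith)
    nlinarith
  have := div_nonneg hN hD.le
  constructor <;> linarith

theorem finite_range_of_complexity (f : ℝ → ℝ) (k : ℕ) (h : HasComplexity f k) :
    (Set.range f).Finite := by
  obtain ⟨b, hb, h1, h2⟩ := h
  have hA : (f '' {x | ∀ j : Fin k, x < b j}).Finite := by
    apply Set.Subsingleton.finite
    rintro _ ⟨x, hx, rfl⟩ _ ⟨z, hz, rfl⟩
    exact h1 x z hx hz
  refine (hA.union (Set.finite_range (fun i => f (b i)))).subset ?_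
  rintro _ ⟨x, rfl⟩
  by_cases hx : ∀ j : Fin k, x < b j
  · exact Or.inl ⟨x, hx, rfl⟩
  · right
    push Not at hx
    obtain ⟨j, hj⟩ := hx
    have hne : (Finset.univ.filter (fun i : Fin k => b i ≤ x)).Nonempty := ⟨j, by simp [hj]⟩
    obtain ⟨i, hi, hmax⟩ := Finset.exists_max_image _ id hne
    simp only [Finset.mem_filter, Finset.mem_univ, true_and, id] at hi hmax
    refine ⟨i, h2 i (b i) x le_rfl hi (fun j hj => hb hj) (fun j hj => ?_)⟩
    by_contra hcon
    exact absurd (hmax j (not_lt.1 hcon)) (not_le.2 hj)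

theorem locConst (f : ℝ → ℝ) (hfin : (Set.range f).Finite) (x : ℝ) (hx : ContinuousAt f x) :
    ∀ᶠ z in 𝓝 x, f z = f x := by
  have hcl : IsClosed (Set.range f \ {f x}) := (hfin.subset Set.sdiff_subset).isClosed
  have hmem : (Set.range f \ {f x})ᶜ ∈ 𝓝 (f x) := hcl.isOpen_compl.mem_nhds (by simp)
  filter_upwards [hx hmem] with z hz
  by_contra hne
  exact hz ⟨⟨z, rfl⟩, hne⟩

theorem stTraj_pol (CE : ℝ) (g : ℝ → ℝ) (y : ℝ) (n : ℕ) :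
    stTraj CE (fun n => g (polTraj CE g y n)) y n = polTraj CE g y n := by
  induction n with
  | zero => rfl
  | succ n ih => simp only [stTraj, polTraj, ih]

theorem polTraj_add (CE : ℝ) (g : ℝ → ℝ) (y : ℝ) (s n : ℕ) :
    polTraj CE g (polTraj CE g y s) n = polTraj CE g y (s + n) := by
  induction n with
  | zero => rfl
  | succ n ih => rw [← add_assoc]; simp only [polTraj, ih]

theorem summable_payoff (γ c CR CE K : ℝ) (f : ℝ → ℝ)
    (hγ : γ ∈ Set.Ioo (0:ℝ) 1) (hc : c ∈ Set.Icc (0:ℝ) 1)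
    (hf01 : ∀ x, f x ∈ Set.Icc (0:ℝ) 1) (hCR : 0 ≤ CR) (x : ℕ → ℝ) (a : ℕ → ℝ)
    (ha : IsActionSeq K a) :
    Summable (fun t : ℕ => (CR + a t) *
      ∏ τ ∈ Finset.range t, (γ * ftilde γ c f (x (τ + 1)))) := by
  refine Summable.of_norm_bounded (g := fun t => (CR + K) * γ ^ t)
    ((summable_geometric_of_lt_one hγ.1.le hγ.2).mul_left _) (fun t => ?_)
  have hft := fun z => ftilde_mem γ c f hγ hc hf01 z
  have hP0 : 0 ≤ ∏ τ ∈ Finset.range t, (γ * ftilde γ c f (x (τ + 1))) :=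
    Finset.prod_nonneg fun i _ => mul_nonneg hγ.1.le (hft _).1
  have hP1 : ∏ τ ∈ Finset.range t, (γ * ftilde γ c f (x (τ + 1))) ≤ γ ^ t := by
    calc _ ≤ ∏ τ ∈ Finset.range t, γ := Finset.prod_le_prod
          (fun i _ => mul_nonneg hγ.1.le (hft _).1)
          (fun i _ => mul_le_of_le_one_right hγ.1.le (hft _).2)
      _ = γ ^ t := by simp
  have hK := ha t
  rw [Real.norm_eq_abs, abs_mul, abs_of_nonneg hP0]
  have : |CR + a t| ≤ CR + K := by rw [abs_le]; constructor <;> linarith [hK.1, hK.2]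
  exact mul_le_mul this hP1 hP0 (le_trans (abs_nonneg _) this)

theorem core (γ c CR CE K : ℝ) (f : ℝ → ℝ) (k : ℕ)
    (hγ : γ ∈ Set.Ioo (0:ℝ) 1) (hc : c ∈ Set.Icc (0:ℝ) 1) (hCR : 0 ≤ CR)
    (hf01 : ∀ x, f x ∈ Set.Icc (0:ℝ) 1) (hcomp : HasComplexity f k)
    (g : ℝ → ℝ) (hopt : IsOptimal γ c CR CE K f g)
    (y : ℝ) (n : ℕ) (hn : 1 ≤ n)
    (hcont : ∀ i : ℕ, 1 ≤ i → i ≤ n → ContinuousAt f (polTraj CE g y i)) :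
    g y = K ∨ g (polTraj CE g y n) = -K := by
  by_contra hcon
  push Not at hcon
  obtain ⟨hy, hyn⟩ := hcon
  have hgy : g y < K := lt_of_le_of_ne (hopt.1 y).2 hy
  have hgn : -K < g (polTraj CE g y n) := lt_of_le_of_ne (hopt.1 _).1 (Ne.symm hyn)
  have hfin := finite_range_of_complexity f k hcomp
  -- choose the size of the perturbation
  have hev : ∀ᶠ δ in 𝓝[>] (0:ℝ), (∀ i ∈ Finset.Icc 1 n,
      f (polTraj CE g y i - δ) = f (polTraj CE g y i)) ∧ δ < K - g y ∧
      δ < g (polTraj CE g y n) + K ∧ 0 < δ := by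
    have e1 : ∀ᶠ δ in 𝓝[>] (0:ℝ), ∀ i ∈ Finset.Icc 1 n,
        f (polTraj CE g y i - δ) = f (polTraj CE g y i) := by
      rw [Filter.eventually_all_finset]
      intro i hi
      rw [Finset.mem_Icc] at hi
      have ht : Tendsto (fun δ : ℝ => polTraj CE g y i - δ) (𝓝 0) (𝓝 (polTraj CE g y i)) := by
        have : ContinuousAt (fun δ : ℝ => polTraj CE g y i - δ) 0 := by fun_prop
        simpa [ContinuousAt] using this
      exact (ht.mono_left nhdsWithin_le_nhds).eventually
        (locConst f hfin _ (hcont i hi.1 hi.2))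
    have e2 : ∀ᶠ δ in 𝓝[>] (0:ℝ), δ < K - g y :=
      nhdsWithin_le_nhds (eventually_lt_nhds (by linarith))
    have e3 : ∀ᶠ δ in 𝓝[>] (0:ℝ), δ < g (polTraj CE g y n) + K :=
      nhdsWithin_le_nhds (eventually_lt_nhds (by linarith))
    filter_upwards [e1, e2, e3, self_mem_nhdsWithin] with δ h1 h2 h3 h4
    exact ⟨h1, h2, h3, h4⟩
  obtain ⟨δ, hδf, hδ1, hδ2, hδ0⟩ := hev.exists
  set a : ℕ → ℝ := fun m => g (polTraj CE g y m) with ha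
  set a' : ℕ → ℝ := fun m => a m + ((if m = 0 then δ else 0) - (if m = n then δ else 0)) with ha'
  have hact : IsActionSeq K a := fun m => hopt.1 _
  have hact' : IsActionSeq K a' := by
    intro m
    have hm := hact m
    rw [Set.mem_Icc] at hm ⊢
    have ha0 : a 0 = g y := rfl
    have han : a n = g (polTraj CE g y n) := rfl
    simp only [ha']
    by_cases h0 : m = 0
    · subst h0
      rw [if_pos rfl, if_neg (by omega)]
      constructor <;> linarith
    · by_cases h1 : m = n
      · subst h1
        rw [if_neg h0, if_pos rfl]
        constructor <;> linarith
      · rw [if_neg h0, if_neg h1]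
        constructor <;> linarith
  have htraj : ∀ m, stTraj CE a' y m =
      polTraj CE g y m - (if 1 ≤ m ∧ m ≤ n then δ else 0) := by
    intro m
    induction m with
    | zero => simp [stTraj, polTraj]
    | succ m ih =>
      rw [stTraj, ih, polTraj]
      simp only [ha', ha]
      split_ifs <;> first | omega | ring
  have hft : ∀ m, ftilde γ c f (stTraj CE a' y (m + 1)) =
      ftilde γ c f (stTraj CE a y (m + 1)) := by
    intro m
    have : f (stTraj CE a' y (m + 1)) = f (stTraj CE a y (m + 1)) := by
      rw [htraj, stTraj_pol]
      split_ifs with h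
      · exact hδf _ (Finset.mem_Icc.2 h)
      · rw [sub_zero]
    simp only [ftilde, this]
  have hle := hopt.2 y a' hact'
  unfold polPayoff payoff at hle
  simp only [hft] at hle
  set P : ℕ → ℝ := fun t => ∏ τ ∈ Finset.range t, (γ * ftilde γ c f (stTraj CE a y (τ + 1)))
    with hP
  have hs : Summable (fun t => (CR + a t) * P t) :=
    summable_payoff γ c CR CE K f hγ hc hf01 hCR (stTraj CE a y) a hact
  have hs' : Summable (fun t => (CR + a' t) * P t) :=
    summable_payoff γ c CR CE K f hγ hc hf01 hCR (stTraj CE a y) a' hact'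
  have hle' : ∑' t, (CR + a' t) * P t ≤ ∑' t, (CR + a t) * P t := hle
  have hdiff : ∑' t, (CR + a' t) * P t - ∑' t, (CR + a t) * P t = δ * P 0 - δ * P n := by
    rw [← hs'.tsum_sub hs]
    have heq : ∀ t, (CR + a' t) * P t - (CR + a t) * P t =
        ((if t = 0 then δ else 0) - (if t = n then δ else 0)) * P t := by
      intro t; simp only [ha']; ring
    simp only [heq]
    rw [tsum_eq_sum (s := {0, n})]
    · rw [Finset.sum_pair (by omega)]
      rw [if_pos rfl, if_neg (by omega), if_neg (by omega), if_pos rfl]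
      ring
    · intro t ht
      simp only [Finset.mem_insert, Finset.mem_singleton, not_or] at ht
      simp [ht.1, ht.2]
  have hP0 : P 0 = 1 := by simp [hP]
  have hmem := fun z => ftilde_mem γ c f hγ hc hf01 z
  have hPn : P n < 1 := by
    calc P n ≤ ∏ τ ∈ Finset.range n, γ := Finset.prod_le_prod
          (fun i _ => mul_nonneg hγ.1.le (hmem _).1)
          (fun i _ => mul_le_of_le_one_right hγ.1.le (hmem _).2)
      _ = γ ^ n := by simp
      _ < 1 := pow_lt_one₀ hγ.1.le hγ.2 (by omega)
  nlinarith

/-- Trajectory lemma: along a stretch of the optimal trajectory where the states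
`x₂, …, x_T` avoid discontinuities of `f` (here `polTraj CE g y (t-1)` is the paper's
`x_t`), if the last action is not maximally increasing the state then all earlier actions
maximally decrease it, and if the first action is not maximally decreasing the state then
all later actions maximally increase it. -/
theorem stmt2 (γ c CR CE K : ℝ) (f : ℝ → ℝ) (k : ℕ)
    (hγ : γ ∈ Set.Ioo (0:ℝ) 1) (hc : c ∈ Set.Icc (0:ℝ) 1) (hK : 0 < K)
    (hCE0 : 0 ≤ CE) (hCEK : CE < K) (hCR : 0 ≤ CR)
    (hfmono : Monotone f) (hf01 : ∀ x, f x ∈ Set.Icc (0:ℝ) 1)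
    (hk : 1 ≤ k) (hcomp : HasComplexity f k)
    (g : ℝ → ℝ) (hopt : IsOptimal γ c CR CE K f g)
    (y : ℝ) (T : ℕ) (hT : 2 ≤ T)
    (hcont : ∀ t : ℕ, 2 ≤ t → t ≤ T → ContinuousAt f (polTraj CE g y (t - 1))) :
    (g (polTraj CE g y (T - 1)) > -K →
      ∀ t : ℕ, 1 ≤ t → t ≤ T - 1 → g (polTraj CE g y (t - 1)) = K) ∧
    (g (polTraj CE g y 0) < K →
      ∀ t : ℕ, 2 ≤ t → t ≤ T → g (polTraj CE g y (t - 1)) = -K) := by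
  have key : ∀ s t : ℕ, s < t → t < T →
      g (polTraj CE g y s) = K ∨ g (polTraj CE g y t) = -K := by
    intro s t hst ht
    have h := core γ c CR CE K f k hγ hc hCR hf01 hcomp g hopt (polTraj CE g y s) (t - s)
      (by omega) (fun i h1 h2 => by
        rw [polTraj_add]
        have := hcont (s + i + 1) (by omega) (by omega)
        simpa using this)
    rwa [polTraj_add, show s + (t - s) = t by omega] at h
  constructor
  · intro h t h1 h2
    exact (key (t - 1) (T - 1) (by omega) (by omega)).resolve_right (ne_of_gt h)
  · intro h t h1 h2
    exact (key 0 (t - 1) (by omega) (by omega)).resolve_left (ne_of_lt h)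
end
end

section
/- Suppose the demand function f has complexity k for some finite k ≥ 1. Let g be a simple policy and x₀ ∈ ℝ an initial state such that the action trajectory of g from x₀ satisfies lim_{t→∞} g(x_t) = −K (the actions converge to maximally boosting the user state). Then g is not optimal: there exist an initial state x ∈ ℝ and an action sequence a with J_x(a) > J_x(g). -/
noncomputable section

open Filter Topology

theorem aux_ftilde_mem (γ c : ℝ) (f : ℝ → ℝ) (x : ℝ)
    (hγ : γ ∈ Set.Ioo (0:ℝ) 1) (hc : c ∈ Set.Icc (0:ℝ) 1) (hf : f x ∈ Set.Icc (0:ℝ) 1) :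
    0 ≤ ftilde γ c f x ∧ ftilde γ c f x ≤ 1 := by
  obtain ⟨h1, h2⟩ := hγ
  obtain ⟨h3, h4⟩ := hc
  obtain ⟨h5, h6⟩ := hf
  unfold ftilde
  have hq : 0 ≤ (1 - c) * f x := mul_nonneg (by linarith) h5
  have hqg : 0 ≤ γ * ((1 - c) * f x) := mul_nonneg h1.le hq
  have hD : 0 < 1 - γ * (1 - (1 - c) * f x) := by nlinarith
  have hn : (1 - f x) * (1 - c) * f x * γ = (1 - f x) * (γ * ((1 - c) * f x)) := by ring
  rw [hn]
  constructor
  · have : 0 ≤ (1 - f x) * (γ * ((1 - c) * f x)) / (1 - γ * (1 - (1 - c) * f x)) :=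
      div_nonneg (mul_nonneg (by linarith) hqg) hD.le
    linarith
  · have : (1 - f x) * (γ * ((1 - c) * f x)) / (1 - γ * (1 - (1 - c) * f x)) ≤ 1 - f x := by
      rw [div_le_iff₀ hD]
      apply mul_le_mul_of_nonneg_left _ (by linarith)
      nlinarith
    linarith

theorem aux_polTraj_shift (CE : ℝ) (g : ℝ → ℝ) (x0 : ℝ) (T n : ℕ) :
    polTraj CE g (polTraj CE g x0 T) n = polTraj CE g x0 (T + n) := by
  induction n with
  | zero => rfl
  | succ n ih => rw [← add_assoc, polTraj, polTraj, ih]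

theorem aux_stTraj_pol (CE : ℝ) (g : ℝ → ℝ) (x0 : ℝ) (n : ℕ) :
    stTraj CE (fun n => g (polTraj CE g x0 n)) x0 n = polTraj CE g x0 n := by
  induction n with
  | zero => rfl
  | succ n ih => rw [stTraj, polTraj, ih]

theorem aux_stTraj_const (CE : ℝ) (x0 : ℝ) (n : ℕ) :
    stTraj CE (fun _ => CE) x0 n = x0 := by
  induction n with
  | zero => rfl
  | succ n ih => rw [stTraj, ih]; ring

theorem aux_payoff (γ c CR CE B : ℝ) (f : ℝ → ℝ) (x : ℝ) (a : ℕ → ℝ)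
    (hB : ∀ u v, B ≤ u → B ≤ v → f u = f v) (hst : ∀ n, B ≤ stTraj CE a x n) :
    payoff γ c CR CE f x a = ∑' t : ℕ, (CR + a t) * (γ * ftilde γ c f B) ^ t := by
  unfold payoff
  congr 1
  funext t
  congr 1
  have : ∀ τ ∈ Finset.range t, γ * ftilde γ c f (stTraj CE a x (τ + 1)) = γ * ftilde γ c f B := by
    intro τ _
    unfold ftilde
    rw [hB _ B (hst (τ + 1)) le_rfl]
  rw [Finset.prod_congr rfl this]
  simp

theorem aux_summable (CR K d : ℝ) (a : ℕ → ℝ) (hd0 : 0 ≤ d) (hd1 : d < 1) (hCR : 0 ≤ CR)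
    (ha : IsActionSeq K a) : Summable (fun t : ℕ => (CR + a t) * d ^ t) := by
  refine Summable.of_norm_bounded (g := fun t : ℕ => (CR + K) * d ^ t)
    ((summable_geometric_of_lt_one hd0 hd1).mul_left _) ?_
  intro t
  rw [Real.norm_eq_abs, abs_mul, abs_of_nonneg (pow_nonneg hd0 t)]
  apply mul_le_mul_of_nonneg_right _ (pow_nonneg hd0 t)
  obtain ⟨h1, h2⟩ := ha t
  rw [abs_le]
  constructor <;> linarith

/-- A simple policy whose action trajectory from some initial state converges to
maximally boosting the user state (`g(x_t) → −K`) is not optimal: some action sequence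
strictly beats it from some initial state. -/
theorem stmt4 (γ c CR CE K : ℝ) (f : ℝ → ℝ) (k : ℕ)
    (hγ : γ ∈ Set.Ioo (0:ℝ) 1) (hc : c ∈ Set.Icc (0:ℝ) 1) (hK : 0 < K)
    (hCE0 : 0 ≤ CE) (hCEK : CE < K) (hCR : 0 ≤ CR)
    (hfmono : Monotone f) (hf01 : ∀ x, f x ∈ Set.Icc (0:ℝ) 1)
    (hk : 1 ≤ k) (hcomp : HasComplexity f k)
    (g : ℝ → ℝ) (hg : IsSimplePolicy K g) (x0 : ℝ)
    (hlim : Tendsto (fun t : ℕ => g (polTraj CE g x0 t)) atTop (nhds (-K))) :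
    ∃ x : ℝ, ∃ a : ℕ → ℝ, IsActionSeq K a ∧
      polPayoff γ c CR CE f g x < payoff γ c CR CE f x a := by
  have hactg : ∀ x, IsActionSeq K (fun n => g (polTraj CE g x n)) := fun x n => hg _
  have hactc : IsActionSeq K (fun _ => CE) := fun _ => ⟨by linarith, hCEK.le⟩
  obtain ⟨b, -, -, hb⟩ := hcomp
  obtain ⟨B, hB⟩ : ∃ B, ∀ u v, B ≤ u → B ≤ v → f u = f v := by
    refine ⟨b ⟨k - 1, by omega⟩, fun u v hu hv => hb _ u v hu hv ?_ ?_⟩ <;>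
    · intro j hj
      have := j.2
      rw [Fin.lt_def] at hj
      simp only at hj
      omega
  obtain ⟨T, hT⟩ := eventually_atTop.1 (hlim.eventually (gt_mem_nhds (show -K < -K / 2 by linarith)))
  have hgrow : ∀ n : ℕ, polTraj CE g x0 T + n * (K / 2) ≤ polTraj CE g x0 (T + n) := by
    intro n
    induction n with
    | zero => simp
    | succ n ih =>
      have := hT (T + n) (by omega)
      rw [← add_assoc, polTraj]
      push_cast
      linarith
  obtain ⟨N, hN⟩ := exists_nat_ge ((B - polTraj CE g x0 T) / (K / 2))
  rw [div_le_iff₀ (by linarith)] at hN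
  have hge : ∀ n, B ≤ polTraj CE g x0 (T + N + n) := by
    intro n
    have h := hgrow (N + n)
    rw [← add_assoc] at h
    push_cast at h
    have : 0 ≤ (n:ℝ) * (K / 2) := by positivity
    linarith
  set x := polTraj CE g x0 (T + N) with hx
  refine ⟨x, fun _ => CE, hactc, ?_⟩
  unfold polPayoff
  have hmem := aux_ftilde_mem γ c f B hγ hc (hf01 B)
  obtain ⟨hg0, hg1⟩ := hγ
  have hd0 : 0 ≤ γ * ftilde γ c f B := mul_nonneg hg0.le hmem.1
  have hd1 : γ * ftilde γ c f B < 1 := by nlinarith [hmem.1, hmem.2]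
  rw [aux_payoff γ c CR CE B f x _ hB
      (fun n => by rw [aux_stTraj_pol, hx, aux_polTraj_shift]; exact hge n),
    aux_payoff γ c CR CE B f x _ hB (fun n => by rw [aux_stTraj_const]; exact hge 0)]
  have hlt : ∀ n, g (polTraj CE g x n) < CE := by
    intro n
    rw [hx, aux_polTraj_shift]
    have := hT (T + N + n) (by omega)
    linarith
  refine Summable.tsum_lt_tsum (i := 0) ?_ ?_ (aux_summable CR K _ _ hd0 hd1 hCR (hactg x))
    (aux_summable CR K _ _ hd0 hd1 hCR hactc)
  · intro n
    exact mul_le_mul_of_nonneg_right (by linarith [hlt n]) (pow_nonneg hd0 n)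
  · simpa using hlt 0
end
end

section
/- Suppose the demand function f has complexity k for some finite k ≥ 1, and let g* be an optimal simple policy with the greedy tie-breaking property: for every x ∈ ℝ, Q(g*(x), x) = sup_{i ∈ [−K,K]} Q(i, x), and g*(x) ≥ i for every i ∈ [−K,K] with Q(i, x) = sup_{i' ∈ [−K,K]} Q(i', x). Then the trajectories of g* started from two ordered initial states never cross: if x₀ ≤ x̂₀ and (x_t), (x̂_t) denote the trajectories of g* from x₁ = x₀ and x̂₁ = x̂₀ respectively, then x_t ≤ x̂_t for every t ≥ 1. -/
noncomputable section

open Filter Topology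

lemma ftilde_nonneg_le_one (γ c : ℝ) (f : ℝ → ℝ)
    (hγ : γ ∈ Set.Ioo (0:ℝ) 1) (hc : c ∈ Set.Icc (0:ℝ) 1)
    (hf01 : ∀ x, f x ∈ Set.Icc (0:ℝ) 1) (x : ℝ) :
    0 ≤ ftilde γ c f x ∧ ftilde γ c f x ≤ 1 := by
  obtain ⟨h0, h1⟩ := hf01 x
  obtain ⟨g0, g1⟩ := hγ
  obtain ⟨c0, c1⟩ := hc
  unfold ftilde
  generalize f x = p at *
  have hq : 0 ≤ (1 - c) * p := mul_nonneg (by linarith) h0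
  have hqγ : 0 ≤ γ * ((1 - c) * p) := mul_nonneg g0.le hq
  have hD : 0 < 1 - γ * (1 - (1 - c) * p) := by linarith
  have hN : 0 ≤ (1 - p) * (1 - c) * p * γ := by
    have := mul_nonneg (sub_nonneg.2 h1) hqγ
    linarith
  constructor
  · have := div_nonneg hN hD.le
    linarith
  · have : (1 - p) * (1 - c) * p * γ / (1 - γ * (1 - (1 - c) * p)) ≤ 1 - p := by
      rw [div_le_iff₀ hD]
      have := mul_nonneg (sub_nonneg.2 h1) (sub_nonneg.2 g1.le)
      linarith
    linarith

lemma payoff_le_bound (γ c CR CE K : ℝ) (f : ℝ → ℝ)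
    (hγ : γ ∈ Set.Ioo (0:ℝ) 1) (hc : c ∈ Set.Icc (0:ℝ) 1) (hCR : 0 ≤ CR)
    (hf01 : ∀ x, f x ∈ Set.Icc (0:ℝ) 1) (x : ℝ) (a : ℕ → ℝ) (ha : IsActionSeq K a) :
    payoff γ c CR CE f x a ≤ (CR + K) * (1 - γ)⁻¹ := by
  have hs : HasSum (fun t : ℕ => (CR + K) * γ ^ t) ((CR + K) * (1 - γ)⁻¹) :=
    (hasSum_geometric_of_lt_one hγ.1.le hγ.2).mul_left _
  refine (Real.le_norm_self _).trans (tsum_of_norm_bounded hs fun t => ?_)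
  rw [norm_mul, norm_prod]
  have h1 : ‖CR + a t‖ ≤ CR + K := by
    rw [Real.norm_eq_abs, abs_le]
    obtain ⟨h, h'⟩ := ha t
    constructor <;> linarith
  have h2 : ∏ τ ∈ Finset.range t, ‖γ * ftilde γ c f (stTraj CE a x (τ + 1))‖ ≤ γ ^ t := by
    calc _ ≤ ∏ τ ∈ Finset.range t, γ := by
          refine Finset.prod_le_prod (fun _ _ => norm_nonneg _) fun τ _ => ?_
          obtain ⟨h, h'⟩ := ftilde_nonneg_le_one γ c f hγ hc hf01 (stTraj CE a x (τ + 1))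
          rw [Real.norm_of_nonneg (mul_nonneg hγ.1.le h)]
          exact mul_le_of_le_one_right hγ.1.le h'
      _ = γ ^ t := by simp
  exact mul_le_mul h1 h2 (Finset.prod_nonneg fun _ _ => norm_nonneg _)
    ((norm_nonneg _).trans h1)

lemma Q_bddAbove (γ c CR CE K : ℝ) (f : ℝ → ℝ)
    (hγ : γ ∈ Set.Ioo (0:ℝ) 1) (hc : c ∈ Set.Icc (0:ℝ) 1) (hK : 0 < K) (hCR : 0 ≤ CR)
    (hf01 : ∀ x, f x ∈ Set.Icc (0:ℝ) 1) (x : ℝ) :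
    BddAbove (Set.range fun i' : Set.Icc (-K) K => Q γ c CR CE K f i' x) := by
  have hB : 0 ≤ (CR + K) * (1 - γ)⁻¹ :=
    mul_nonneg (by linarith) (inv_nonneg.2 (by linarith [hγ.2]))
  refine ⟨CR + K + (CR + K) * (1 - γ)⁻¹, ?_⟩
  rintro _ ⟨⟨i, hi⟩, rfl⟩
  have hV : V γ c CR CE K f (x + CE - i) ≤ (CR + K) * (1 - γ)⁻¹ := by
    refine Real.sSup_le ?_ hB
    rintro _ ⟨a, ha, rfl⟩
    exact payoff_le_bound γ c CR CE K f hγ hc hCR hf01 _ a ha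
  obtain ⟨h, h'⟩ := ftilde_nonneg_le_one γ c f hγ hc hf01 (x + CE - i)
  have h1 : γ * ftilde γ c f (x + CE - i) ≤ 1 := mul_le_one₀ hγ.2.le h h'
  have h2 := mul_le_mul_of_nonneg_left hV (mul_nonneg hγ.1.le h)
  have h3 := mul_le_mul_of_nonneg_right h1 hB
  have h4 := hi.2
  simp only [Q]
  linarith

/-- Trajectories of the greedy-tie-breaking optimal simple policy started from two
ordered initial states never cross. -/
theorem stmt6 (γ c CR CE K : ℝ) (f : ℝ → ℝ) (k : ℕ)
    (hγ : γ ∈ Set.Ioo (0:ℝ) 1) (hc : c ∈ Set.Icc (0:ℝ) 1) (hK : 0 < K)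
    (hCE0 : 0 ≤ CE) (hCEK : CE < K) (hCR : 0 ≤ CR)
    (hfmono : Monotone f) (hf01 : ∀ x, f x ∈ Set.Icc (0:ℝ) 1)
    (hk : 1 ≤ k) (hcomp : HasComplexity f k)
    (g : ℝ → ℝ) (hopt : IsOptimal γ c CR CE K f g)
    (hgreedy : ∀ x : ℝ,
      Q γ c CR CE K f (g x) x = (⨆ i' : Set.Icc (-K) K, Q γ c CR CE K f i' x) ∧
      ∀ i ∈ Set.Icc (-K) K,
        Q γ c CR CE K f i x = (⨆ i' : Set.Icc (-K) K, Q γ c CR CE K f i' x) → i ≤ g x) :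
    ∀ x0 xhat0 : ℝ, x0 ≤ xhat0 →
      ∀ t : ℕ, polTraj CE g x0 t ≤ polTraj CE g xhat0 t := by
  have step : ∀ x y : ℝ, x ≤ y → x + CE - g x ≤ y + CE - g y := by
    intro x y hxy
    by_contra hlt
    push Not at hlt
    obtain ⟨gx1, gx2⟩ := hopt.1 x
    obtain ⟨gy1, gy2⟩ := hopt.1 y
    have hi : x - y + g y ∈ Set.Icc (-K) K := ⟨by linarith, by linarith⟩
    have hj : y - x + g x ∈ Set.Icc (-K) K := ⟨by linarith, by linarith⟩
    have hx := le_ciSup (Q_bddAbove γ c CR CE K f hγ hc hK hCR hf01 x) ⟨_, hi⟩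
    have hy := le_ciSup (Q_bddAbove γ c CR CE K f hγ hc hK hCR hf01 y) ⟨_, hj⟩
    have hg := (hgreedy x).2 _ hi
    rw [← (hgreedy x).1] at hx hg
    rw [← (hgreedy y).1] at hy
    have e1 : x + CE - (x - y + g y) = y + CE - g y := by ring
    have e2 : y + CE - (y - x + g x) = x + CE - g x := by ring
    simp only [Q, e1, e2] at hx hy hg
    have := hg (by linarith)
    linarith
  intro x0 xhat0 h t
  induction t with
  | zero => exact h
  | succ n ih => exact step _ _ ih
end
end

section
/- (Greedy revenue optimization at extreme states.) In the deterministic linear model (with any monotone demand function f), for every ε > 0 there exists a threshold x* ∈ ℝ such that for every user state x ≥ x* and every action i ∈ [−K,K], the greedy highest-revenue action K is ε-optimal: Q(K, x) ≥ Q(i, x) − ε. Likewise, there exists a threshold x° ∈ ℝ such that for every x ≤ x° and every i ∈ [−K,K], Q(K, x) ≥ Q(i, x) − ε. -/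
noncomputable section

open Filter Topology

lemma ft_mem {γ c : ℝ} {f : ℝ → ℝ} (hγ : γ ∈ Set.Ioo (0:ℝ) 1) (hc : c ∈ Set.Icc (0:ℝ) 1)
    (hf01 : ∀ x, f x ∈ Set.Icc (0:ℝ) 1) (x : ℝ) :
    0 ≤ ftilde γ c f x ∧ ftilde γ c f x ≤ 1 := by
  obtain ⟨h0, h1⟩ := hf01 x
  obtain ⟨g0, g1⟩ := hγ
  obtain ⟨c0, c1⟩ := hc
  unfold ftilde
  have hs : 0 ≤ γ * ((1 - c) * f x) :=
    mul_nonneg g0.le (mul_nonneg (by linarith) h0)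
  have hd : 0 < 1 - γ * (1 - (1 - c) * f x) := by nlinarith
  constructor
  · have : 0 ≤ ((1 - f x) * (1 - c) * f x * γ) / (1 - γ * (1 - (1 - c) * f x)) := by
      apply div_nonneg _ hd.le
      have : 0 ≤ 1 - f x := by linarith
      have : 0 ≤ 1 - c := by linarith
      positivity
    linarith
  · have : ((1 - f x) * (1 - c) * f x * γ) / (1 - γ * (1 - (1 - c) * f x)) ≤ 1 - f x := by
      rw [div_le_iff₀ hd]
      have : 0 ≤ (1 - f x) * (1 - γ) := mul_nonneg (by linarith) (by linarith)
      nlinarith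
    linarith

lemma ft_mono {γ c : ℝ} {f : ℝ → ℝ} (hγ : γ ∈ Set.Ioo (0:ℝ) 1) (hc : c ∈ Set.Icc (0:ℝ) 1)
    (hfmono : Monotone f) (hf01 : ∀ x, f x ∈ Set.Icc (0:ℝ) 1) :
    Monotone (ftilde γ c f) := by
  obtain ⟨g0, g1⟩ := hγ
  obtain ⟨c0, c1⟩ := hc
  have key : ∀ x, 0 < 1 - γ * (1 - (1 - c) * f x) ∧
      ftilde γ c f x = 1 - (1 - f x) * ((1 - γ) / (1 - γ * (1 - (1 - c) * f x))) := by
    intro x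
    obtain ⟨h0, h1⟩ := hf01 x
    have hs : 0 ≤ γ * ((1 - c) * f x) :=
      mul_nonneg g0.le (mul_nonneg (by linarith) h0)
    have hd : 0 < 1 - γ * (1 - (1 - c) * f x) := by nlinarith
    refine ⟨hd, ?_⟩
    unfold ftilde
    have hd' := hd.ne'
    rw [← mul_div_assoc, eq_sub_iff_add_eq, add_assoc, ← add_div]
    have : (1 - f x) * (1 - c) * f x * γ + (1 - f x) * (1 - γ)
      = (1 - f x) * (1 - γ * (1 - (1 - c) * f x)) := by ring
    rw [this, mul_div_assoc, div_self hd']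
    ring
  intro x y hxy
  have hf := hfmono hxy
  rw [(key x).2, (key y).2]
  have h1 : (1 - γ) / (1 - γ * (1 - (1 - c) * f y)) ≤ (1 - γ) / (1 - γ * (1 - (1 - c) * f x)) := by
    apply div_le_div_of_nonneg_left (by linarith) (key x).1
    have : (1 - c) * f x ≤ (1 - c) * f y := mul_le_mul_of_nonneg_left hf (by linarith)
    nlinarith
  have h2 : 0 ≤ (1 - γ) / (1 - γ * (1 - (1 - c) * f y)) :=
    div_nonneg (by linarith) (key y).1.le
  have := mul_le_mul (show 1 - f y ≤ 1 - f x by linarith) h1 h2 (by linarith [(hf01 x).2])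
  linarith

/-- Comparison series. -/
def Sser (γ M δ : ℝ) (h : ℝ → ℝ) (x : ℝ) : ℝ :=
  ∑' t : ℕ, M * ∏ τ ∈ Finset.range t, (γ * h (x + ((τ:ℝ) + 1) * δ))

lemma prod_bd {γ : ℝ} (hγ : γ ∈ Set.Ioo (0:ℝ) 1) (u : ℕ → ℝ)
    (hu : ∀ n, 0 ≤ u n ∧ u n ≤ 1) (t : ℕ) :
    0 ≤ ∏ τ ∈ Finset.range t, (γ * u τ) ∧ ∏ τ ∈ Finset.range t, (γ * u τ) ≤ γ ^ t := by
  have h0 : ∀ n, 0 ≤ γ * u n := fun n => mul_nonneg hγ.1.le (hu n).1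
  refine ⟨Finset.prod_nonneg fun n _ => h0 n, ?_⟩
  calc _ ≤ ∏ τ ∈ Finset.range t, γ :=
        Finset.prod_le_prod (fun n _ => h0 n)
          (fun n _ => mul_le_of_le_one_right hγ.1.le (hu n).2)
    _ = γ ^ t := by simp

lemma term_bd {γ M b : ℝ} (hγ : γ ∈ Set.Ioo (0:ℝ) 1) (u : ℕ → ℝ)
    (hu : ∀ n, 0 ≤ u n ∧ u n ≤ 1) (t : ℕ) (hb : |b| ≤ M) :
    ‖b * ∏ τ ∈ Finset.range t, (γ * u τ)‖ ≤ M * γ ^ t := by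
  obtain ⟨p0, p1⟩ := prod_bd hγ u hu t
  rw [norm_mul, Real.norm_eq_abs, Real.norm_eq_abs, abs_of_nonneg p0]
  exact mul_le_mul hb p1 p0 ((abs_nonneg b).trans hb)

lemma summ_bd {γ M : ℝ} (hγ : γ ∈ Set.Ioo (0:ℝ) 1) : Summable fun t : ℕ => M * γ ^ t :=
  (summable_geometric_of_lt_one hγ.1.le hγ.2).mul_left M

lemma summ_term {γ M : ℝ} (hγ : γ ∈ Set.Ioo (0:ℝ) 1) (u b : ℕ → ℝ)
    (hu : ∀ n, 0 ≤ u n ∧ u n ≤ 1) (hb : ∀ n, |b n| ≤ M) :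
    Summable fun t : ℕ => b t * ∏ τ ∈ Finset.range t, (γ * u τ) :=
  Summable.of_norm_bounded (summ_bd hγ) (fun t => term_bd hγ u hu t (hb t))

lemma Sser_tendsto {γ M δ L : ℝ} {h : ℝ → ℝ} (hγ : γ ∈ Set.Ioo (0:ℝ) 1) (hM : 0 ≤ M)
    (hh : ∀ x, 0 ≤ h x ∧ h x ≤ 1) {l : Filter ℝ}
    (hl : ∀ r : ℝ, Tendsto (fun x => x + r) l l)
    (hL : Tendsto h l (𝓝 L)) :
    Tendsto (Sser γ M δ h) l (𝓝 (∑' t : ℕ, M * ∏ _τ ∈ Finset.range t, (γ * L))) := by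
  unfold Sser
  apply tendsto_tsum_of_dominated_convergence (summ_bd (M := M) hγ)
  · intro t
    refine Tendsto.const_mul _ (tendsto_finsetProd _ fun τ _ => ?_)
    exact (hL.comp (hl _)).const_mul _
  · refine Eventually.of_forall fun x t => ?_
    exact term_bd hγ (fun τ => h (x + ((τ:ℝ) + 1) * δ)) (fun n => hh _) t
      (abs_of_nonneg hM).le

lemma traj_const (CE K x : ℝ) (n : ℕ) :
    stTraj CE (fun _ => K) x n = x + (n:ℝ) * (CE - K) := by
  induction n with
  | zero => simp [stTraj]
  | succ n ih => rw [stTraj, ih]; push_cast; ring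

lemma traj_le {CE K : ℝ} {a : ℕ → ℝ} (ha : IsActionSeq K a) (x : ℝ) (n : ℕ) :
    stTraj CE a x n ≤ x + (n:ℝ) * (CE + K) := by
  induction n with
  | zero => simp [stTraj]
  | succ n ih => rw [stTraj]; push_cast; linarith [(ha n).1]

section
variable {γ c CR CE K : ℝ} {f : ℝ → ℝ}

lemma payoff_le (hγ : γ ∈ Set.Ioo (0:ℝ) 1) (hc : c ∈ Set.Icc (0:ℝ) 1) (hK : 0 < K)
    (hCR : 0 ≤ CR)
    (hfmono : Monotone f) (hf01 : ∀ x, f x ∈ Set.Icc (0:ℝ) 1) {a : ℕ → ℝ}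
    (ha : IsActionSeq K a) (x : ℝ) :
    payoff γ c CR CE f x a ≤ Sser γ (CR + K) (CE + K) (ftilde γ c f) x := by
  have hm := ft_mem hγ hc hf01
  unfold payoff Sser
  refine Summable.tsum_le_tsum (fun t => ?_)
    (summ_term (M := CR + K) hγ (fun τ => ftilde γ c f (stTraj CE a x (τ + 1)))
      (fun t => CR + a t) (fun n => hm _)
      (fun n => abs_le.2 ⟨by linarith [(ha n).1], by linarith [(ha n).2]⟩))
    (summ_term (M := CR + K) hγ (fun τ : ℕ => ftilde γ c f (x + ((τ:ℝ) + 1) * (CE + K)))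
      (fun t => CR + K) (fun n => hm _)
      (fun n => (abs_of_nonneg (by linarith)).le))
  refine mul_le_mul (by linarith [(ha t).2]) ?_
    (prod_bd hγ (fun τ => ftilde γ c f (stTraj CE a x (τ + 1))) (fun n => hm _) t).1
    (by linarith)
  refine Finset.prod_le_prod (fun n _ => mul_nonneg hγ.1.le (hm _).1) (fun n _ => ?_)
  refine mul_le_mul_of_nonneg_left (ft_mono hγ hc hfmono hf01 ?_) hγ.1.le
  have := traj_le (CE := CE) ha x (n + 1)
  push_cast at this
  exact this

lemma V_bounds (hγ : γ ∈ Set.Ioo (0:ℝ) 1) (hc : c ∈ Set.Icc (0:ℝ) 1) (hK : 0 < K)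
    (hCR : 0 ≤ CR)
    (hfmono : Monotone f) (hf01 : ∀ x, f x ∈ Set.Icc (0:ℝ) 1) (x : ℝ) :
    Sser γ (CR + K) (CE - K) (ftilde γ c f) x ≤ V γ c CR CE K f x ∧
    V γ c CR CE K f x ≤ Sser γ (CR + K) (CE + K) (ftilde γ c f) x := by
  have hKa : IsActionSeq K (fun _ => K) := fun n => ⟨by linarith, le_refl _⟩
  have hub : ∀ v ∈ {v : ℝ | ∃ a : ℕ → ℝ, IsActionSeq K a ∧ payoff γ c CR CE f x a = v},
      v ≤ Sser γ (CR + K) (CE + K) (ftilde γ c f) x := by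
    rintro v ⟨a, ha, rfl⟩
    exact payoff_le hγ hc hK hCR hfmono hf01 ha x
  constructor
  · refine le_csSup ⟨_, hub⟩ ⟨_, hKa, ?_⟩
    unfold payoff Sser
    simp only [traj_const]
    push_cast
    rfl
  · exact csSup_le ⟨_, _, hKa, rfl⟩ hub

lemma W_tendsto (hγ : γ ∈ Set.Ioo (0:ℝ) 1) (hc : c ∈ Set.Icc (0:ℝ) 1) (hK : 0 < K)
    (hCR : 0 ≤ CR)
    (hfmono : Monotone f) (hf01 : ∀ x, f x ∈ Set.Icc (0:ℝ) 1) {l : Filter ℝ} {L : ℝ}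
    (hl : ∀ r : ℝ, Tendsto (fun x => x + r) l l)
    (hL : Tendsto (ftilde γ c f) l (𝓝 L)) :
    ∃ A, Tendsto (fun x => γ * ftilde γ c f x * V γ c CR CE K f x) l (𝓝 A) := by
  have hm := ft_mem hγ hc hf01
  have hb := fun x => V_bounds (CE := CE) hγ hc hK hCR hfmono hf01 x
  refine ⟨_, (hL.const_mul γ).mul (tendsto_of_tendsto_of_tendsto_of_le_of_le
    (Sser_tendsto (M := CR + K) (δ := CE - K) hγ (by linarith) hm hl hL)
    (Sser_tendsto (M := CR + K) (δ := CE + K) hγ (by linarith) hm hl hL)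
    (fun x => (hb x).1) (fun x => (hb x).2))⟩

end

/-- Greedy revenue optimization at extreme states: for every `ε > 0`, at all sufficiently
high user states and at all sufficiently low user states, showing the highest-revenue
content `K` is `ε`-optimal. -/
theorem stmt8 (γ c CR CE K : ℝ) (f : ℝ → ℝ)
    (hγ : γ ∈ Set.Ioo (0:ℝ) 1) (hc : c ∈ Set.Icc (0:ℝ) 1) (hK : 0 < K)
    (hCE0 : 0 ≤ CE) (hCEK : CE < K) (hCR : 0 ≤ CR)
    (hfmono : Monotone f) (hf01 : ∀ x, f x ∈ Set.Icc (0:ℝ) 1)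
    (ε : ℝ) (hε : 0 < ε) :
    (∃ xstar : ℝ, ∀ x : ℝ, xstar ≤ x → ∀ i ∈ Set.Icc (-K) K,
      Q γ c CR CE K f i x - ε ≤ Q γ c CR CE K f K x) ∧
    (∃ xcirc : ℝ, ∀ x : ℝ, x ≤ xcirc → ∀ i ∈ Set.Icc (-K) K,
      Q γ c CR CE K f i x - ε ≤ Q γ c CR CE K f K x) := by
  have hm := ft_mem hγ hc hf01
  have hmono := ft_mono hγ hc hfmono hf01
  have fin : ∀ A u v : ℝ, ∀ i ∈ Set.Icc (-K) K, dist u A < ε / 2 → dist v A < ε / 2 →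
      CR + i + u - ε ≤ CR + K + v := by
    intro A u v i hi hu hv
    rw [Real.dist_eq, abs_lt] at hu hv
    linarith [hi.2, hu.2, hv.1]
  have hKm : K ∈ Set.Icc (-K) K := ⟨by linarith, le_refl _⟩
  constructor
  · obtain ⟨A, hA⟩ := W_tendsto (CE := CE) hγ hc hK hCR hfmono hf01
      (fun r => tendsto_atTop_add_const_right atTop r tendsto_id)
      (tendsto_atTop_ciSup hmono ⟨1, by rintro _ ⟨x, rfl⟩; exact (hm x).2⟩)
    obtain ⟨N, hN⟩ := eventually_atTop.1 (Metric.tendsto_nhds.1 hA (ε / 2) (by linarith))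
    refine ⟨N + K, fun x hx i hi => ?_⟩
    exact fin A _ _ i hi (hN _ (by linarith [hi.2])) (hN _ (by linarith))
  · obtain ⟨A, hA⟩ := W_tendsto (CE := CE) hγ hc hK hCR hfmono hf01
      (fun r => tendsto_atBot_add_const_right atBot r tendsto_id)
      (tendsto_atBot_ciInf hmono ⟨0, by rintro _ ⟨x, rfl⟩; exact (hm x).1⟩)
    obtain ⟨N, hN⟩ := eventually_atBot.1 (Metric.tendsto_nhds.1 hA (ε / 2) (by linarith))
    refine ⟨N - K - CE, fun x hx i hi => ?_⟩
    exact fin A _ _ i hi (hN _ (by linarith [hi.1])) (hN _ (by linarith))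
end
end

section
/- Let γ = 0.9. For c ∈ [0,1] define g(c) := 1/(1 − γ·f̃_{γ,c}(0.99)) − 1/(1 − γ·f̃_{γ,c}(0.6)). Then g(c) > 0 for every c ∈ [0,1], and g is strictly increasing on [0,1]. (This is the key claim in the proof of Proposition B.1: under the optimal content policy, higher friction leads the app to sustain strictly higher user satisfaction, because the asymptotic value gap between the high-demand level 0.99 and the moderate-demand level 0.6 grows with friction.) -/
noncomputable section

theorem gap_high (c : ℝ) (h1 : c ≤ 1) :
    1 / (1 - 0.9 * ftildeVal 0.9 c 0.99) = 10 - 0.09 / (0.109 + 0.891 * (1 - c)) := by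
  obtain ⟨u, rfl⟩ : ∃ u, c = 1 - u := ⟨1 - c, by ring⟩
  have hu : 0 ≤ u := by linarith
  have hD : (0.1 + 0.891 * u : ℝ) ≠ 0 := by positivity
  have hB : (0.109 + 0.891 * u : ℝ) ≠ 0 := by positivity
  have e : 1 - 0.9 * ftildeVal 0.9 (1 - u) 0.99
      = 0.1 * (0.109 + 0.891 * u) / (0.1 + 0.891 * u) := by
    have : (1 - 0.9 * (1 - (1 - (1 - u)) * 0.99) : ℝ) = 0.1 + 0.891 * u := by ring
    rw [ftildeVal, this, eq_div_iff hD, sub_mul, mul_assoc, add_mul, div_mul_cancel₀ _ hD]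
    ring
  rw [e, one_div_div, sub_sub_cancel, eq_sub_iff_add_eq, div_add_div _ _ (by positivity) hB,
    div_eq_iff (by positivity)]
  ring

theorem gap_low (c : ℝ) (h1 : c ≤ 1) :
    1 / (1 - 0.9 * ftildeVal 0.9 c 0.6) = 10 - 3.6 / (0.46 + 0.54 * (1 - c)) := by
  obtain ⟨u, rfl⟩ : ∃ u, c = 1 - u := ⟨1 - c, by ring⟩
  have hu : 0 ≤ u := by linarith
  have hD : (0.1 + 0.54 * u : ℝ) ≠ 0 := by positivity
  have hB : (0.46 + 0.54 * u : ℝ) ≠ 0 := by positivity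
  have e : 1 - 0.9 * ftildeVal 0.9 (1 - u) 0.6
      = 0.1 * (0.46 + 0.54 * u) / (0.1 + 0.54 * u) := by
    have : (1 - 0.9 * (1 - (1 - (1 - u)) * 0.6) : ℝ) = 0.1 + 0.54 * u := by ring
    rw [ftildeVal, this, eq_div_iff hD, sub_mul, mul_assoc, add_mul, div_mul_cancel₀ _ hD]
    ring
  rw [e, one_div_div, sub_sub_cancel, eq_sub_iff_add_eq, div_add_div _ _ (by positivity) hB,
    div_eq_iff (by positivity)]
  ring

/-- For `γ = 0.9`, the asymptotic value gap
`g(c) = 1/(1 − γ·f̃_{γ,c}(0.99)) − 1/(1 − γ·f̃_{γ,c}(0.6))` is positive and strictly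
increasing in the friction parameter `c` on `[0,1]`. -/
theorem stmt11 :
    (∀ c ∈ Set.Icc (0:ℝ) 1,
      0 < 1 / (1 - 0.9 * ftildeVal 0.9 c 0.99) - 1 / (1 - 0.9 * ftildeVal 0.9 c 0.6)) ∧
    StrictMonoOn
      (fun c : ℝ =>
        1 / (1 - 0.9 * ftildeVal 0.9 c 0.99) - 1 / (1 - 0.9 * ftildeVal 0.9 c 0.6))
      (Set.Icc (0:ℝ) 1) := by
  constructor
  · rintro c ⟨h0, h1⟩
    rw [gap_high c h1, gap_low c h1]
    have : 0.09 / (0.109 + 0.891 * (1 - c)) < 3.6 / (0.46 + 0.54 * (1 - c)) := by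
      rw [div_lt_div_iff₀ (by linarith) (by linarith)]
      linarith
    linarith
  · rintro a ⟨ha0, ha1⟩ b ⟨hb0, hb1⟩ hab
    simp only
    rw [gap_high a ha1, gap_low a ha1, gap_high b hb1, gap_low b hb1]
    obtain ⟨u, rfl⟩ : ∃ u, a = 1 - u := ⟨1 - a, by ring⟩
    obtain ⟨v, rfl⟩ : ∃ v, b = 1 - v := ⟨1 - b, by ring⟩
    have hu : 0 ≤ u := by linarith
    have hv : 0 ≤ v := by linarith
    have huv : 0 < u - v := by linarith
    simp only [sub_sub_cancel]
    have e1 : 3.6 / (0.46 + 0.54 * v) - 3.6 / (0.46 + 0.54 * u)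
        = (u - v) * (1.944 / ((0.46 + 0.54 * v) * (0.46 + 0.54 * u))) := by
      rw [div_sub_div _ _ (by positivity) (by positivity), ← mul_div_assoc]
      congr 1
      ring
    have e2 : 0.09 / (0.109 + 0.891 * v) - 0.09 / (0.109 + 0.891 * u)
        = (u - v) * (0.08019 / ((0.109 + 0.891 * v) * (0.109 + 0.891 * u))) := by
      rw [div_sub_div _ _ (by positivity) (by positivity), ← mul_div_assoc]
      congr 1
      ring
    have key : 0.08019 / ((0.109 + 0.891 * v) * (0.109 + 0.891 * u))
        < 1.944 / ((0.46 + 0.54 * v) * (0.46 + 0.54 * u)) := by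
      rw [div_lt_div_iff₀ (by positivity) (by positivity)]
      nlinarith [mul_nonneg hu hv]
    have := mul_lt_mul_of_pos_left key huv
    linarith
end
end

section
/- (Cross-partial derivative in the comparative statics of friction.) Fix γ ∈ (0,1) and define F(p, c) := γ·f̃_{γ,c}(p) / (1 − γ·f̃_{γ,c}(p)). Then for every p ∈ [0,1] and c ∈ [0,1], the mixed partial derivative of F — the derivative in c of the function c' ↦ (∂F/∂p)(p, c') — equals γ²·((2 − c·γ)·p − 1) / ((1 − γ)·(1 − γ·c·p)³). In particular, whenever (2 − c·γ)·p > 1, this cross-partial is strictly positive, so a marginal increase in friction increases the marginal value of user satisfaction. -/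
noncomputable section

/-- The discounted continuation factor `F(p,c) = γ·f̃_{γ,c}(p)/(1 − γ·f̃_{γ,c}(p))`. -/
def F (γ p c : ℝ) : ℝ :=
  γ * ftildeVal γ c p / (1 - γ * ftildeVal γ c p)

open Filter Topology in
/-- Closed form of `F`. -/
theorem F_closed (γ p c : ℝ) (h1 : 0 < 1 - γ) (hD : 0 < 1 - γ * (1 - (1 - c) * p))
    (hE : 0 < 1 - γ * c * p) :
    F γ p c = γ * (1 - c * γ) * p / ((1 - γ) * (1 - γ * c * p)) := by
  have hf : ftildeVal γ c p
      = (p * (1 - γ) + (1 - c) * p * γ) / (1 - γ * (1 - (1 - c) * p)) := by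
    unfold ftildeVal
    rw [eq_div_iff hD.ne', add_mul, div_mul_cancel₀ _ hD.ne']
    ring
  have hg : 1 - γ * ftildeVal γ c p
      = ((1 - γ) * (1 - γ * c * p)) / (1 - γ * (1 - (1 - c) * p)) := by
    rw [hf, eq_div_iff hD.ne', sub_mul, mul_assoc, div_mul_cancel₀ _ hD.ne']
    ring
  unfold F
  rw [hg, hf, ← mul_div_assoc, div_div_div_cancel_right₀ hD.ne']
  congr 1
  ring

open Filter Topology in
theorem F_deriv_p (γ p c : ℝ) (h1 : 0 < 1 - γ) (hD : 0 < 1 - γ * (1 - (1 - c) * p))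
    (hE : 0 < 1 - γ * c * p) :
    deriv (fun p' : ℝ => F γ p' c) p
      = γ * (1 - c * γ) / ((1 - γ) * (1 - γ * c * p) ^ 2) := by
  have e : (fun p' : ℝ => F γ p' c) =ᶠ[𝓝 p]
      fun p' => γ * (1 - c * γ) * p' / ((1 - γ) * (1 - γ * c * p')) := by
    have a1 : ∀ᶠ p' in 𝓝 p, 0 < 1 - γ * (1 - (1 - c) * p') :=
      ContinuousAt.eventually_lt (f := fun _ => (0:ℝ)) (g := fun p' => 1 - γ * (1 - (1 - c) * p'))
        continuousAt_const (by fun_prop) hD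
    have a2 : ∀ᶠ p' in 𝓝 p, 0 < 1 - γ * c * p' :=
      ContinuousAt.eventually_lt (f := fun _ => (0:ℝ)) (g := fun p' => 1 - γ * c * p')
        continuousAt_const (by fun_prop) hE
    filter_upwards [a1, a2] with p' b1 b2
    exact F_closed γ p' c h1 b1 b2
  rw [e.deriv_eq]
  have n : HasDerivAt (fun p' : ℝ => γ * (1 - c * γ) * p') (γ * (1 - c * γ) * 1) p :=
    (hasDerivAt_id p).const_mul _
  have d : HasDerivAt (fun p' : ℝ => (1 - γ) * (1 - γ * c * p'))
      ((1 - γ) * (-(γ * c * 1))) p :=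
    (((hasDerivAt_id p).const_mul (γ * c)).const_sub 1).const_mul _
  rw [(n.fun_div d (mul_pos h1 hE).ne').deriv,
    div_eq_div_iff (pow_pos (mul_pos h1 hE) 2).ne' (mul_pos h1 (pow_pos hE 2)).ne']
  ring

/-- Cross-partial derivative in the comparative statics of friction:
`∂²F/∂c∂p = γ²·((2 − cγ)·p − 1)/((1 − γ)·(1 − γcp)³)`; in particular it is strictly
positive whenever `(2 − cγ)·p > 1`. -/
theorem stmt13 (γ p c : ℝ) (hγ : γ ∈ Set.Ioo (0:ℝ) 1)
    (hp : p ∈ Set.Icc (0:ℝ) 1) (hc : c ∈ Set.Icc (0:ℝ) 1) :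
    deriv (fun c' : ℝ => deriv (fun p' : ℝ => F γ p' c') p) c
      = γ ^ 2 * ((2 - c * γ) * p - 1) / ((1 - γ) * (1 - γ * c * p) ^ 3) ∧
    ((2 - c * γ) * p > 1 →
      0 < deriv (fun c' : ℝ => deriv (fun p' : ℝ => F γ p' c') p) c) := by
  obtain ⟨hg0, hg1⟩ := hγ
  obtain ⟨hp0, hp1⟩ := hp
  obtain ⟨hc0, hc1⟩ := hc
  have h1 : 0 < 1 - γ := by linarith
  have hD : 0 < 1 - γ * (1 - (1 - c) * p) := by
    have := mul_nonneg hg0.le (mul_nonneg (sub_nonneg.2 hc1) hp0)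
    nlinarith
  have hE : 0 < 1 - γ * c * p := by
    have : c * p ≤ 1 := mul_le_one₀ hc1 hp0 hp1
    nlinarith
  have key : deriv (fun c' : ℝ => deriv (fun p' : ℝ => F γ p' c') p) c
      = γ ^ 2 * ((2 - c * γ) * p - 1) / ((1 - γ) * (1 - γ * c * p) ^ 3) := by
    have e : (fun c' : ℝ => deriv (fun p' : ℝ => F γ p' c') p) =ᶠ[nhds c]
        fun c' => γ * (1 - c' * γ) / ((1 - γ) * (1 - γ * c' * p) ^ 2) := by
      have a1 : ∀ᶠ c' in nhds c, 0 < 1 - γ * (1 - (1 - c') * p) :=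
        ContinuousAt.eventually_lt (f := fun _ => (0:ℝ)) (g := fun c' => 1 - γ * (1 - (1 - c') * p))
        continuousAt_const (by fun_prop) hD
      have a2 : ∀ᶠ c' in nhds c, 0 < 1 - γ * c' * p :=
        ContinuousAt.eventually_lt (f := fun _ => (0:ℝ)) (g := fun c' => 1 - γ * c' * p)
        continuousAt_const (by fun_prop) hE
      filter_upwards [a1, a2] with c' b1 b2
      exact F_deriv_p γ p c' h1 b1 b2
    rw [e.deriv_eq]
    have n : HasDerivAt (fun c' : ℝ => γ * (1 - c' * γ)) (γ * (-(1 * γ))) c :=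
      (((hasDerivAt_id c).mul_const γ).const_sub 1).const_mul _
    have d0 : HasDerivAt (fun c' : ℝ => 1 - γ * c' * p) (-(γ * 1 * p)) c :=
      (((hasDerivAt_id c).const_mul γ).mul_const p).const_sub 1
    have d := (d0.fun_pow 2).const_mul (1 - γ)
    have hpos := mul_pos h1 (pow_pos hE 2)
    rw [(n.fun_div d hpos.ne').deriv,
      div_eq_div_iff (pow_pos hpos 2).ne' (mul_pos h1 (pow_pos hE 3)).ne']
    push_cast
    ring
  refine ⟨key, fun h => ?_⟩
  rw [key]
  exact div_pos (mul_pos (pow_pos hg0 2) (by linarith)) (mul_pos h1 (pow_pos hE 3))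
end
end

section
/- (Modified demand elasticity strictly increases with friction.) Fix γ ∈ (0,1) and p ∈ (0,1]. Then the modified demand elasticity at demand level p, namely the derivative at p of the function p' ↦ log f̃_{γ,c}(p'), is a strictly increasing function of the friction parameter c on [0,1]. (Equivalently: d/dp log f̃_{γ,c}(p) = 1/p − γ·(1−c)/(1 − γ + γ·(1−c)·p), and this expression is strictly increasing in c ∈ [0,1].) -/
noncomputable section

/-- Modified demand elasticity strictly increases with friction: for fixed `γ ∈ (0,1)`
and `p ∈ (0,1]`, the derivative at `p` of `p' ↦ log f̃_{γ,c}(p')` equals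
`1/p − γ(1−c)/(1 − γ + γ(1−c)p)` and is strictly increasing in `c` on `[0,1]`. -/
theorem stmt14 (γ p : ℝ) (hγ : γ ∈ Set.Ioo (0:ℝ) 1) (hp : p ∈ Set.Ioc (0:ℝ) 1) :
    (∀ c ∈ Set.Icc (0:ℝ) 1,
      deriv (fun p' : ℝ => Real.log (ftildeVal γ c p')) p
        = 1 / p - γ * (1 - c) / (1 - γ + γ * (1 - c) * p)) ∧
    StrictMonoOn
      (fun c : ℝ => deriv (fun p' : ℝ => Real.log (ftildeVal γ c p')) p)
      (Set.Icc (0:ℝ) 1) := by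
  obtain ⟨hγ0, hγ1⟩ := hγ
  obtain ⟨hp0, hp1⟩ := hp
  have hD : ∀ c ∈ Set.Icc (0:ℝ) 1, ∀ q : ℝ, 0 < q → 0 < 1 - γ + γ * (1 - c) * q := by
    intro c hc q hq
    have h1 : 0 ≤ γ * (1 - c) * q :=
      mul_nonneg (mul_nonneg hγ0.le (by linarith [hc.2])) hq.le
    linarith
  have key : ∀ c ∈ Set.Icc (0:ℝ) 1,
      deriv (fun p' : ℝ => Real.log (ftildeVal γ c p')) p
        = 1 / p - γ * (1 - c) / (1 - γ + γ * (1 - c) * p) := by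
    intro c hc
    have hK : 0 < 1 - γ + γ * (1 - c) := by
      have := hD c hc 1 one_pos
      linarith
    have hev : (fun p' : ℝ => Real.log (ftildeVal γ c p')) =ᶠ[nhds p]
        (fun p' : ℝ => Real.log p' + Real.log (1 - γ + γ * (1 - c))
          - Real.log (1 - γ + γ * (1 - c) * p')) := by
      filter_upwards [lt_mem_nhds hp0] with q hq
      have hDq := hD c hc q hq
      have hf : ftildeVal γ c q
          = q * (1 - γ + γ * (1 - c)) / (1 - γ + γ * (1 - c) * q) := by
        unfold ftildeVal
        have e : 1 - γ * (1 - (1 - c) * q) = 1 - γ + γ * (1 - c) * q := by ring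
        rw [e, eq_div_iff hDq.ne', add_mul, div_mul_cancel₀ _ hDq.ne']
        ring
      rw [hf, Real.log_div (mul_pos hq hK).ne' hDq.ne', Real.log_mul hq.ne' hK.ne']
    rw [hev.deriv_eq]
    have hd : HasDerivAt (fun p' : ℝ => 1 - γ + γ * (1 - c) * p') (γ * (1 - c)) p := by
      simpa using ((hasDerivAt_id p).const_mul (γ * (1 - c))).const_add (1 - γ)
    have h1 := ((Real.hasDerivAt_log hp0.ne').add_const
      (Real.log (1 - γ + γ * (1 - c)))).sub (hd.log (hD c hc p hp0).ne')
    rw [one_div]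
    exact h1.deriv
  refine ⟨key, ?_⟩
  intro c hc d hd hcd
  simp only
  rw [key c hc, key d hd]
  apply sub_lt_sub_left
  rw [div_lt_div_iff₀ (hD d hd p hp0) (hD c hc p hp0)]
  have : 0 < γ * (1 - γ) * (d - c) :=
    mul_pos (mul_pos hγ0 (by linarith)) (by linarith)
  nlinarith
end
end

section
/- (Ratio of modified demand elasticities at complete versus no friction grows linearly in demand.) Fix γ ∈ (0,1) and p ∈ (0,1]. Then the ratio of the modified demand elasticity under complete friction (c = 1) to that under no friction (c = 0) satisfies: (d/dp log f̃_{γ,1}(p)) / (d/dp log f̃_{γ,0}(p)) = 1 + γ·p/(1 − γ). Equivalently, since f̃_{γ,1}(p) = p, one has (1/p) / (d/dp log f̃_{γ,0}(p)) = 1 + γ·p/(1 − γ). -/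
noncomputable section

/-- The ratio of the modified demand elasticity under complete friction (`c = 1`) to
that under no friction (`c = 0`) equals `1 + γ·p/(1 − γ)`; equivalently, since
`f̃_{γ,1}(p) = p`, the ratio `(1/p) / (d/dp log f̃_{γ,0}(p))` equals the same value. -/
theorem stmt15 (γ p : ℝ) (hγ : γ ∈ Set.Ioo (0:ℝ) 1) (hp : p ∈ Set.Ioc (0:ℝ) 1) :
    deriv (fun p' : ℝ => Real.log (ftildeVal γ 1 p')) p
        / deriv (fun p' : ℝ => Real.log (ftildeVal γ 0 p')) p
      = 1 + γ * p / (1 - γ) ∧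
    (1 / p) / deriv (fun p' : ℝ => Real.log (ftildeVal γ 0 p')) p
      = 1 + γ * p / (1 - γ) := by
  obtain ⟨h0, h1⟩ := hγ
  obtain ⟨hp0, hp1⟩ := hp
  have hD : 0 < 1 - γ + γ * p := by nlinarith [mul_pos h0 hp0]
  have hg : (1 - γ) ≠ 0 := by linarith
  have e1 : deriv (fun p' : ℝ => Real.log (ftildeVal γ 1 p')) p = 1 / p := by
    have : (fun p' : ℝ => Real.log (ftildeVal γ 1 p')) = Real.log := by
      funext x
      simp [ftildeVal]
    rw [this, Real.deriv_log, one_div]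
  have e0 : deriv (fun p' : ℝ => Real.log (ftildeVal γ 0 p')) p
      = 1 / p - γ / (1 - γ + γ * p) := by
    have hev : (fun p' : ℝ => Real.log (ftildeVal γ 0 p')) =ᶠ[nhds p]
        (fun x : ℝ => Real.log x - Real.log (1 - γ + γ * x)) := by
      filter_upwards [lt_mem_nhds hp0] with x hx
      have hDx : 0 < 1 - γ + γ * x := by nlinarith [mul_pos h0 hx]
      rw [← Real.log_div hx.ne' hDx.ne']
      congr 1
      have hd : 1 - γ * (1 - (1 - 0) * x) = 1 - γ + γ * x := by ring
      unfold ftildeVal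
      rw [hd, eq_div_iff hDx.ne', add_mul, div_mul_cancel₀ _ hDx.ne']
      ring
    rw [hev.deriv_eq]
    have hlin : HasDerivAt (fun x : ℝ => 1 - γ + γ * x) γ p := by
      simpa using ((hasDerivAt_id p).const_mul γ).const_add (1 - γ)
    have := (Real.hasDerivAt_log hp0.ne').sub (hlin.log hD.ne')
    rw [one_div]
    exact this.deriv
  have key : (1 / p) / (1 / p - γ / (1 - γ + γ * p)) = 1 + γ * p / (1 - γ) := by
    have h2 : 1 / p - γ / (1 - γ + γ * p) = (1 - γ) / (p * (1 - γ + γ * p)) := by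
      rw [div_sub_div _ _ hp0.ne' hD.ne']
      congr 1
      ring
    have := hp0.ne'
    have := hD.ne'
    rw [h2]
    field_simp
  rw [e1, e0]
  exact ⟨key, key⟩
end
end
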